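/- Fix a layered episodic MDP with transition function P and a policy π, generate a random trajectory under π, and let c be a real random variable on the same probability space with 0 ≤ c ≤ 1 almost surely. Fix s ∈ S ∖ {s_L} and a ∈ A with q(s,a) > 0, and define the loss estimator ℓ̂(s,a) = c·( 𝕀(s,a)/q(s,a) − 𝕀(s)/q(s) ). Then its second moment satisfies E[ ℓ̂(s,a)² ] ≤ (1 − π(a|s)) / q(s,a). -/

import Mathlib

open MeasureTheory Finset

/-- A layered episodic MDP: finite state set `S` partitioned into layers `0, …, L` by `layer`,
with unique initial state `s0` (layer `0`), unique terminal state `sL` (layer `L`),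
nonempty layers, and a transition function `P` supported on consecutive layers with rows
summing to `1` on non-terminal layers. -/
structure LayeredMDP (S A : Type) [Fintype S] [Fintype A] where
  L : ℕ
  layer : S → ℕ
  s0 : S
  sL : S
  P : S → A → S → ℝ
  layer_le : ∀ s, layer s ≤ L
  layer_s0 : layer s0 = 0
  layer_sL : layer sL = L
  s0_unique : ∀ s, layer s = 0 → s = s0
  sL_unique : ∀ s, layer s = L → s = sL
  layer_nonempty : ∀ k, k ≤ L → ∃ s, layer s = k
  P_nonneg : ∀ s a s', 0 ≤ P s a s'
  P_layer : ∀ s a s', P s a s' ≠ 0 → layer s' = layer s + 1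
  P_sum : ∀ s a, layer s < L → ∑ s', P s a s' = 1

variable {S A : Type} [Fintype S] [Fintype A] [DecidableEq S] [DecidableEq A]

/-- `pol` is a policy: nonnegative, and rows sum to `1` at every non-terminal state. -/
def IsPolicy (M : LayeredMDP S A) (pol : S → A → ℝ) : Prop :=
  (∀ s a, 0 ≤ pol s a) ∧ ∀ s, s ≠ M.sL → ∑ a, pol s a = 1

/-- State-action value function computed with `n` remaining layers of fuel. -/
noncomputable def Qfuel (M : LayeredMDP S A) (pol l : S → A → ℝ) :
    ℕ → S → A → ℝ
  | 0, _, _ => 0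
  | n + 1, s, a => l s a + ∑ s', M.P s a s' * ∑ a', pol s' a' * Qfuel M pol l n s' a'

/-- The state-action value function `Q^{P,π}(s,a; ℓ)`. -/
noncomputable def Qval (M : LayeredMDP S A) (pol l : S → A → ℝ) (s : S) (a : A) : ℝ :=
  if M.layer s = M.L then 0 else Qfuel M pol l (M.L - M.layer s) s a

/-- The state value function `V^{P,π}(s; ℓ) = ∑_a π(a|s) Q^{P,π}(s,a; ℓ)`. -/
noncomputable def Vval (M : LayeredMDP S A) (pol l : S → A → ℝ) (s : S) : ℝ :=
  ∑ a, pol s a * Qval M pol l s a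

/-- A trajectory `(s_0, a_0, …, s_{L-1}, a_{L-1}, s_L)`. -/
abbrev Traj (M : LayeredMDP S A) : Type := (Fin (M.L + 1) → S) × (Fin M.L → A)

/-- Probability of a given trajectory under policy `pol`. -/
noncomputable def trajProb (M : LayeredMDP S A) (pol : S → A → ℝ) (τ : Traj M) : ℝ :=
  (if τ.1 0 = M.s0 then (1 : ℝ) else 0) *
    ∏ k : Fin M.L, pol (τ.1 k.castSucc) (τ.2 k) * M.P (τ.1 k.castSucc) (τ.2 k) (τ.1 k.succ)

/-- Indicator `𝕀(s)` that the trajectory visits state `s` at its layer. -/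
noncomputable def stInd (M : LayeredMDP S A) (τ : Traj M) (s : S) : ℝ :=
  if τ.1 ⟨M.layer s, Nat.lt_succ_of_le (M.layer_le s)⟩ = s then 1 else 0

/-- Indicator `𝕀(s,a)` that the trajectory visits `(s,a)` at the layer of `s`. -/
noncomputable def saInd (M : LayeredMDP S A) (τ : Traj M) (s : S) (a : A) : ℝ :=
  if h : M.layer s < M.L then
    if τ.1 ⟨M.layer s, Nat.lt_succ_of_le (M.layer_le s)⟩ = s ∧ τ.2 ⟨M.layer s, h⟩ = a then 1
    else 0
  else 0

/-- Occupancy measure `q^{P,π}(s,a) = Pr[(s_k, a_k) = (s,a)]`. -/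
noncomputable def occSA (M : LayeredMDP S A) (pol : S → A → ℝ) (s : S) (a : A) : ℝ :=
  ∑ τ : Traj M, trajProb M pol τ * saInd M τ s a

/-- Occupancy measure `q^{P,π}(s) = Pr[s_k = s]`. -/
noncomputable def occS (M : LayeredMDP S A) (pol : S → A → ℝ) (s : S) : ℝ :=
  ∑ τ : Traj M, trajProb M pol τ * stInd M τ s

/-- Aggregate loss `∑_{k=0}^{L-1} ℓ(s_k, a_k)` of a trajectory. -/
noncomputable def aggLoss (M : LayeredMDP S A) (l : S → A → ℝ) (τ : Traj M) : ℝ :=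
  ∑ k : Fin M.L, l (τ.1 k.castSucc) (τ.2 k)

/-- Sum of `g` over all paths of `n` steps started at `x`, weighted by their probability. -/
noncomputable def pathSum (M : LayeredMDP S A) (pol : S → A → ℝ) (n : ℕ) (x : S)
    (g : (Fin (n + 1) → S) → (Fin n → A) → ℝ) : ℝ :=
  ∑ τ : (Fin (n + 1) → S) × (Fin n → A), (if τ.1 0 = x then (1 : ℝ) else 0) *
    (∏ k : Fin n, pol (τ.1 k.castSucc) (τ.2 k) *
      M.P (τ.1 k.castSucc) (τ.2 k) (τ.1 k.succ)) * g τ.1 τ.2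

omit [DecidableEq A] in
lemma pathSum_zero (M : LayeredMDP S A) (pol : S → A → ℝ) (x : S)
    (g : (Fin 1 → S) → (Fin 0 → A) → ℝ) :
    pathSum M pol 0 x g = g (fun _ => x) Fin.elim0 := by
  unfold pathSum
  rw [Finset.sum_eq_single ((fun _ => x, Fin.elim0) : (Fin 1 → S) × (Fin 0 → A))]
  · simp
  · rintro ⟨σ, α⟩ - hne
    have : σ 0 ≠ x := by
      rintro rfl
      refine hne (Prod.ext (funext fun i => ?_) (Subsingleton.elim _ _))
      rw [Subsingleton.elim i 0]
    simp [this]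
  · simp

omit [DecidableEq A] in
lemma pathSum_succ (M : LayeredMDP S A) (pol : S → A → ℝ) (n : ℕ) (x : S)
    (g : (Fin (n + 2) → S) → (Fin (n + 1) → A) → ℝ) :
    pathSum M pol (n + 1) x g = ∑ b, pol x b * ∑ y, M.P x b y *
      pathSum M pol n y (fun σ α => g (Fin.cons x σ) (Fin.cons b α)) := by
  have inner (b : A) : ∑ y, M.P x b y *
      pathSum M pol n y (fun σ α => g (Fin.cons x σ) (Fin.cons b α)) =
      ∑ σ : Fin (n + 1) → S, ∑ α : Fin n → A, M.P x b (σ 0) *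
        (∏ k : Fin n, pol (σ k.castSucc) (α k) * M.P (σ k.castSucc) (α k) (σ k.succ)) *
          g (Fin.cons x σ) (Fin.cons b α) := by
    simp only [pathSum, Finset.mul_sum]
    rw [Finset.sum_comm, Fintype.sum_prod_type]
    refine Finset.sum_congr rfl fun σ _ => Finset.sum_congr rfl fun α _ => ?_
    rw [Finset.sum_eq_single (σ 0)]
    · simp [mul_assoc]
    · intro y _ hy
      simp [hy.symm]
    · simp
  simp only [inner]
  rw [pathSum, Fintype.sum_prod_type, ← (Fin.consEquiv fun _ => S).sum_comp,
    Fintype.sum_prod_type, Finset.sum_eq_single x]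
  · simp only [Finset.mul_sum]
    rw [Finset.sum_comm (s := (Finset.univ : Finset A))]
    refine Finset.sum_congr rfl fun σ _ => ?_
    rw [← (Fin.consEquiv fun _ => A).sum_comp, Fintype.sum_prod_type]
    refine Finset.sum_congr rfl fun b _ => Finset.sum_congr rfl fun α _ => ?_
    simp [Fin.consEquiv, Fin.prod_univ_succ]
    ring
  · intro y _ hy
    simp [Fin.consEquiv, hy]
  · simp

omit [DecidableEq S] [DecidableEq A] in
/-- Transitions need only be inspected on the next layer. -/
lemma LayeredMDP.sum_P_mul_congr (M : LayeredMDP S A) (x : S) (b : A) {f g : S → ℝ}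
    (h : ∀ y, M.layer y = M.layer x + 1 → f y = g y) :
    ∑ y, M.P x b y * f y = ∑ y, M.P x b y * g y := by
  refine Finset.sum_congr rfl fun y _ => ?_
  by_cases hy : M.P x b y = 0
  · simp [hy]
  · rw [h y (M.P_layer _ _ _ hy)]

omit [DecidableEq S] [DecidableEq A] in
lemma LayeredMDP.ne_sL_of_layer_lt (M : LayeredMDP S A) {x : S} (h : M.layer x < M.L) :
    x ≠ M.sL := by
  rintro rfl
  exact h.ne M.layer_sL

omit [DecidableEq A] in
lemma pathSum_one (M : LayeredMDP S A) (pol : S → A → ℝ) (hpol : IsPolicy M pol) (n : ℕ)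
    (x : S) (hx : M.layer x + n = M.L) : pathSum M pol n x (fun _ _ => 1) = 1 := by
  induction n generalizing x with
  | zero => rw [pathSum_zero]
  | succ n ih =>
    have hlt : M.layer x < M.L := by omega
    have step (b : A) : ∑ y, M.P x b y * pathSum M pol n y (fun _ _ => 1) = 1 := by
      rw [M.sum_P_mul_congr x b (g := fun _ => 1) fun y hy => ih y (by omega)]
      simpa using M.P_sum x b hlt
    rw [pathSum_succ]
    simp only [step, mul_one]
    exact hpol.2 x (M.ne_sL_of_layer_lt hlt)

lemma pathSum_state_action (M : LayeredMDP S A) (pol : S → A → ℝ) (hpol : IsPolicy M pol)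
    (s : S) (a : A) (n : ℕ) (k : Fin n) (x : S) (hx : M.layer x + n = M.L) :
    pathSum M pol n x (fun σ α => if σ k.castSucc = s ∧ α k = a then 1 else 0) =
      pol s a * pathSum M pol n x (fun σ _ => if σ k.castSucc = s then 1 else 0) := by
  induction n generalizing x with
  | zero => exact k.elim0
  | succ n ih =>
    have hlt : M.layer x < M.L := by omega
    have one (b : A) : ∑ y, M.P x b y * pathSum M pol n y (fun _ _ => 1) = 1 := by
      rw [M.sum_P_mul_congr x b (g := fun _ => 1)
        fun y hy => pathSum_one M pol hpol n y (by omega)]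
      simpa using M.P_sum x b hlt
    have zero (y : S) : pathSum M pol n y (fun _ _ => 0) = 0 := by simp [pathSum]
    rw [pathSum_succ, pathSum_succ]
    refine Fin.cases ?_ (fun j => ?_) k
    · simp only [Fin.castSucc_zero, Fin.cons_zero]
      by_cases hxs : x = s
      · subst hxs
        rw [Finset.sum_eq_single a]
        · simp [one, hpol.2 x (M.ne_sL_of_layer_lt hlt)]
        · intro b _ hb
          simp [hb, zero]
        · simp
      · simp [hxs, zero]
    · simp only [← Fin.succ_castSucc, Fin.cons_succ]
      rw [Finset.mul_sum]
      refine Finset.sum_congr rfl fun b _ => ?_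
      rw [M.sum_P_mul_congr x b fun y hy => ih j y (by omega)]
      simp only [Finset.mul_sum, mul_left_comm]

/-- The occupancy measure factors through the policy. -/
lemma occSA_eq_mul_occS (M : LayeredMDP S A) (pol : S → A → ℝ) (hpol : IsPolicy M pol)
    (s : S) (a : A) (hs : s ≠ M.sL) : occSA M pol s a = pol s a * occS M pol s := by
  have hlt : M.layer s < M.L := lt_of_le_of_ne (M.layer_le s) fun h => hs (M.sL_unique s h)
  have h := pathSum_state_action M pol hpol s a M.L ⟨M.layer s, hlt⟩ M.s0
    (by rw [M.layer_s0, zero_add])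
  simp only [occSA, occS, trajProb, saInd, stInd, hlt, dif_pos]
  exact h

omit [DecidableEq S] [DecidableEq A] in
lemma integral_comp_eq_sum {T Ω : Type*} [Fintype T] [MeasurableSpace Ω] (μ : Measure Ω)
    [IsFiniteMeasure μ] (X : Ω → T) (hX : ∀ t, MeasurableSet {ω | X ω = t}) (f : T → ℝ) :
    Integrable (fun ω => f (X ω)) μ ∧
      ∫ ω, f (X ω) ∂μ = ∑ t, (μ {ω | X ω = t}).toReal * f t := by
  let _ : MeasurableSpace T := ⊤
  have hXm : Measurable X := measurable_to_countable' hX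
  have hint : Integrable f (μ.map X) := Integrable.of_finite
  refine ⟨hint.comp_measurable hXm, ?_⟩
  rw [← integral_map hXm.aemeasurable hint.aestronglyMeasurable, integral_fintype hint]
  refine Finset.sum_congr rfl fun t _ => ?_
  rw [Measure.real, Measure.map_apply hXm (MeasurableSet.singleton t), smul_eq_mul]
  rfl

lemma sum_trajProb_mul_sq (M : LayeredMDP S A) (pol : S → A → ℝ) (s : S) (a : A) (u v : ℝ) :
    ∑ τ : Traj M, trajProb M pol τ * (saInd M τ s a * u - stInd M τ s * v) ^ 2 =
      occSA M pol s a * (u ^ 2 - 2 * u * v) + occS M pol s * v ^ 2 := by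
  rw [occSA, occS, Finset.sum_mul, Finset.sum_mul, ← Finset.sum_add_distrib]
  refine Finset.sum_congr rfl fun τ _ => ?_
  unfold saInd stInd
  split_ifs <;> first | (exfalso; tauto) | ring

/-- second moment of the known-transition loss estimator.
If `0 ≤ c ≤ 1` almost surely, then for `s ≠ s_L` and `a` with `q(s,a) > 0`,
`E[ℓ̂(s,a)²] ≤ (1 − π(a|s))/q(s,a)` where
`ℓ̂(s,a) = c·(𝕀(s,a)/q(s,a) − 𝕀(s)/q(s))`. -/
theorem stmt4 (M : LayeredMDP S A) (pol : S → A → ℝ) (hpol : IsPolicy M pol)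
    {Ω : Type} [MeasurableSpace Ω] (μ : Measure Ω) [IsProbabilityMeasure μ]
    (traj : Ω → Traj M) (c : Ω → ℝ)
    (hmeas : ∀ τ : Traj M, MeasurableSet {ω | traj ω = τ})
    (hdist : ∀ τ : Traj M, (μ {ω | traj ω = τ}).toReal = trajProb M pol τ)
    (hcmeas : Measurable c)
    (hc01 : ∀ᵐ ω ∂μ, c ω ∈ Set.Icc (0 : ℝ) 1)
    (s : S) (a : A) (hs : s ≠ M.sL) (hq : 0 < occSA M pol s a) :
    ∫ ω, (c ω * (saInd M (traj ω) s a / occSA M pol s a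
        - stInd M (traj ω) s / occS M pol s)) ^ 2 ∂μ
      ≤ (1 - pol s a) / occSA M pol s a := by
  have hfac := occSA_eq_mul_occS M pol hpol s a hs
  have hS : occS M pol s ≠ 0 := by
    rintro h
    rw [hfac, h, mul_zero] at hq
    exact hq.false
  obtain ⟨hint, heq⟩ := integral_comp_eq_sum μ traj hmeas fun τ =>
    (saInd M τ s a / occSA M pol s a - stInd M τ s / occS M pol s) ^ 2
  refine (integral_mono_of_nonneg (ae_of_all _ fun _ => sq_nonneg _) hint ?_).trans ?_
  · filter_upwards [hc01] with ω hω
    rw [mul_pow]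
    exact mul_le_of_le_one_left (sq_nonneg _) (pow_le_one₀ hω.1 hω.2)
  · rw [heq]
    simp only [hdist, div_eq_mul_inv, sum_trajProb_mul_sq]
    have hpol_ne : pol s a ≠ 0 := by
      rintro h
      rw [hfac, h, zero_mul] at hq
      exact hq.false
    rw [hfac]
    apply le_of_eq
    field_simp
    ring
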